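/- Let z_0, z_1, z_2, z_3 ∈ ℂ be nondegenerate. Let c = (c_{ijk})_{0≤i<j<k≤3} be real numbers and set f(w) = Σ_{0≤i<j<k≤3} c_{ijk} · χ_{convexHull ℝ {z_i,z_j,z_k}}(w). If for every natural number k, ∫_ℂ f(w)·w^k dvolume(w) = 0, then f(w) = 0 for volume-almost every w ∈ ℂ. -/

import Mathlib

open MeasureTheory

/-- A tuple of points in `ℂ` is nondegenerate if the points are pairwise distinct and no
three of them are collinear over `ℝ`. -/
def Nondegenerate {m : ℕ} (z : Fin m → ℂ) : Prop :=
  Function.Injective z ∧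
    ∀ i j k : Fin m, i ≠ j → i ≠ k → j ≠ k → ¬Collinear ℝ ({z i, z j, z k} : Set ℂ)


/-- Twice the signed area of a triangle. -/
noncomputable def crs (a b c : ℂ) : ℝ := (b.re - a.re) * (c.im - a.im) - (b.im - a.im) * (c.re - a.re)

/-- The linear map sending `1` to `u` and `I` to `v`. -/
noncomputable def linA (u v : ℂ) : ℂ →L[ℝ] ℂ :=
  Complex.reCLM.smulRight u + Complex.imCLM.smulRight v

lemma linA_apply (u v w : ℂ) : linA u v w = w.re * u + w.im * v := by
  simp [linA]

lemma linA_det (u v : ℂ) : (linA u v).det = u.re * v.im - u.im * v.re := by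
  rw [ContinuousLinearMap.det, ← LinearMap.det_toMatrix Complex.basisOneI, Matrix.det_fin_two]
  simp [LinearMap.toMatrix_apply, linA_apply]
  ring

lemma hull_image (a b c : ℂ) :
    convexHull ℝ ({a, b, c} : Set ℂ) =
      (fun w => a + linA (b - a) (c - a) w) '' convexHull ℝ ({0, 1, Complex.I} : Set ℂ) := by
  have := AffineMap.image_convexHull
    (AffineMap.const ℝ ℂ a + (linA (b - a) (c - a)).toLinearMap.toAffineMap)
    ({0, 1, Complex.I} : Set ℂ)
  have h2 : (⇑(AffineMap.const ℝ ℂ a + (linA (b - a) (c - a)).toLinearMap.toAffineMap)) =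
      (fun w => a + linA (b - a) (c - a) w) := by
    ext w; simp
  rw [h2] at this
  rw [this]
  simp [Set.image_insert_eq, linA_apply]

lemma hull_compact (a b c : ℂ) : IsCompact (convexHull ℝ ({a, b, c} : Set ℂ)) :=
  Set.Finite.isCompact_convexHull (𝕜 := ℝ) (s := ({a, b, c} : Set ℂ)) (Set.toFinite _)

lemma int_tri (a b c : ℂ) (h : crs a b c ≠ 0) (g : ℂ → ℂ) :
    ∫ w in convexHull ℝ ({a, b, c} : Set ℂ), g w =
      |crs a b c| * ∫ w in convexHull ℝ ({0, 1, Complex.I} : Set ℂ),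
        g (a + linA (b - a) (c - a) w) := by
  have hdet : (linA (b - a) (c - a)).det = crs a b c := by
    rw [linA_det]; simp [crs]
  rw [hull_image a b c, integral_image_eq_integral_abs_det_fderiv_smul (f' := fun _ => linA (b - a) (c - a))]
  · rw [hdet, ← integral_const_mul]
    simp
  · exact (hull_compact _ _ _).measurableSet
  · intro x _
    exact ((linA (b - a) (c - a)).hasFDerivAt.const_add a).hasFDerivWithinAt
  · apply Function.Injective.injOn
    intro x y hxy
    have hxy : linA (b - a) (c - a) x = linA (b - a) (c - a) y := by simpa using hxy
    have h0 := congrArg Complex.re hxy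
    have h1 := congrArg Complex.im hxy
    simp [linA_apply] at h0 h1
    unfold crs at h
    apply Complex.ext
    · apply mul_left_cancel₀ h; linear_combination (c.im - a.im) * h0 - (c.re - a.re) * h1
    · apply mul_left_cancel₀ h; linear_combination (b.re - a.re) * h1 - (b.im - a.im) * h0

lemma int_one (a b c : ℂ) (h : crs a b c ≠ 0) :
    ∫ _w in convexHull ℝ ({a, b, c} : Set ℂ), (1 : ℂ) =
      |crs a b c| * ∫ _w in convexHull ℝ ({0, 1, Complex.I} : Set ℂ), (1 : ℂ) :=
  int_tri a b c h _

lemma int_id_aux (a b c : ℂ) (h : crs a b c ≠ 0) :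
    ∫ w in convexHull ℝ ({a, b, c} : Set ℂ), w =
      |crs a b c| * (a * (∫ _w in convexHull ℝ ({0, 1, Complex.I} : Set ℂ), (1 : ℂ))
        + (b - a) * (∫ w in convexHull ℝ ({0, 1, Complex.I} : Set ℂ), (w.re : ℂ))
        + (c - a) * (∫ w in convexHull ℝ ({0, 1, Complex.I} : Set ℂ), (w.im : ℂ))) := by
  rw [int_tri a b c h (fun w => w)]
  congr 1
  have hc := hull_compact 0 1 Complex.I
  have i1 : IntegrableOn (fun _ : ℂ => a * (1 : ℂ)) (convexHull ℝ ({0, 1, Complex.I} : Set ℂ)) :=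
    ContinuousOn.integrableOn_compact hc (by fun_prop)
  have i2 : IntegrableOn (fun w : ℂ => (b - a) * (w.re : ℂ))
      (convexHull ℝ ({0, 1, Complex.I} : Set ℂ)) :=
    ContinuousOn.integrableOn_compact hc (by fun_prop)
  have i3 : IntegrableOn (fun w : ℂ => (c - a) * (w.im : ℂ))
      (convexHull ℝ ({0, 1, Complex.I} : Set ℂ)) :=
    ContinuousOn.integrableOn_compact hc (by fun_prop)
  rw [← integral_const_mul, ← integral_const_mul, ← integral_const_mul, ← integral_add i1 i2,
    ← integral_add (f := fun w : ℂ => a * (1 : ℂ) + (b - a) * (w.re : ℂ)) (i1.add i2) i3]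
  congr 1
  ext w
  simp only [linA_apply]
  ring

lemma int_id (a b c : ℂ) (h : crs a b c ≠ 0) :
    ∫ w in convexHull ℝ ({a, b, c} : Set ℂ), w =
      |crs a b c| * (∫ _w in convexHull ℝ ({0, 1, Complex.I} : Set ℂ), (1 : ℂ))
        * ((a + b + c) / 3) := by
  have e1 := int_id_aux 0 1 Complex.I (by simp [crs])
  have e2 := int_id_aux 1 0 Complex.I (by simp [crs])
  have e3 := int_id_aux 0 Complex.I 1 (by simp [crs])
  rw [Set.insert_comm, e1] at e2
  rw [Set.pair_comm Complex.I 1, e1] at e3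
  rw [int_id_aux a b c h]
  have hc1 : crs 0 1 Complex.I = 1 := by simp [crs]
  have hc2 : crs 1 0 Complex.I = -1 := by simp [crs]
  have hc3 : crs 0 Complex.I 1 = -1 := by simp [crs]
  rw [hc1, hc2] at e2
  rw [hc1, hc3] at e3
  clear e1
  generalize (∫ _w in convexHull ℝ ({0, 1, Complex.I} : Set ℂ), (1 : ℂ)) = A at *
  generalize (∫ w in convexHull ℝ ({0, 1, Complex.I} : Set ℂ), (w.re : ℂ)) = B at *
  generalize (∫ w in convexHull ℝ ({0, 1, Complex.I} : Set ℂ), (w.im : ℂ)) = C at *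
  norm_num at e2 e3
  have hBC : B = C := by
    have h1 : (1 - Complex.I) * (B - C) = 0 := by linear_combination e3
    rcases mul_eq_zero.1 h1 with h | h
    · have := congrArg Complex.re h
      simp at this
    · exact sub_eq_zero.1 h
  subst hBC
  have hA : A = 3 * B := by linear_combination -e2
  subst hA
  ring

lemma line_null (a b : ℂ) (h : a ≠ b) : ∀ᵐ w : ℂ, crs w a b ≠ 0 := by
  let L : ℂ →ₗ[ℝ] ℝ := (b - a).re • Complex.imLm - (b - a).im • Complex.reLm
  have hL : LinearMap.ker L ≠ ⊤ := by
    intro ht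
    have h1 : (b - a) * Complex.I ∈ LinearMap.ker L := by rw [ht]; trivial
    simp [L] at h1
    apply h
    apply Complex.ext <;> nlinarith [sq_nonneg (b.re - a.re), sq_nonneg (b.im - a.im)]
  have h0 := Measure.addHaar_submodule (volume : Measure ℂ) _ hL
  have h1 := measure_preimage_add_right (volume : Measure ℂ) (-a) (LinearMap.ker L : Set ℂ)
  rw [h0] at h1
  rw [ae_iff]
  refine measure_mono_null ?_ h1
  intro w hw
  simp [L, crs] at hw ⊢
  linear_combination hw

lemma mem_hull (a b c w : ℂ) :
    w ∈ convexHull ℝ ({a, b, c} : Set ℂ) ↔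
      ∃ x y z : ℝ, 0 ≤ x ∧ 0 ≤ y ∧ 0 ≤ z ∧ x + y + z = 1 ∧ x * a + y * b + z * c = w := by
  constructor
  · intro h
    rw [convexHull_insert (by simp), convexHull_pair] at h
    simp only [mem_convexJoin, Set.mem_singleton_iff, exists_eq_left] at h
    obtain ⟨t, ⟨p, q, hp, hq, hpq, rfl⟩, p', q', hp', hq', hpq', rfl⟩ := h
    refine ⟨p', q' * p, q' * q, hp', by positivity, by positivity, ?_, ?_⟩
    · linear_combination hpq' + q' * hpq
    · simp only [Complex.real_smul]
      push_cast
      ring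
  · rintro ⟨x, y, z, hx, hy, hz, hs, rfl⟩
    refine mem_convexHull_of_exists_fintype (ι := Fin 3) ![x, y, z] ![a, b, c] ?_ ?_ ?_ ?_
    · intro i; fin_cases i <;> simpa
    · simpa [Fin.sum_univ_three] using hs
    · intro i; fin_cases i <;> simp
    · simp [Fin.sum_univ_three]

lemma vol_std : (∫ _w in convexHull ℝ ({0, 1, Complex.I} : Set ℂ), (1 : ℂ)) ≠ 0 := by
  have hsub : Metric.ball (⟨1 / 4, 1 / 4⟩ : ℂ) (1 / 8) ⊆
      convexHull ℝ ({0, 1, Complex.I} : Set ℂ) := by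
    intro w hw
    rw [Metric.mem_ball, dist_eq_norm] at hw
    have h1 := abs_le.1 ((Complex.abs_re_le_norm _).trans hw.le)
    have h2 := abs_le.1 ((Complex.abs_im_le_norm _).trans hw.le)
    simp only [Complex.sub_re, Complex.sub_im] at h1 h2
    rw [mem_hull]
    refine ⟨1 - w.re - w.im, w.re, w.im, by linarith, by linarith, by linarith, by ring, ?_⟩
    simp [Complex.re_add_im]
  have hpos : 0 < volume (convexHull ℝ ({0, 1, Complex.I} : Set ℂ)) :=
    (Metric.measure_ball_pos volume _ (by norm_num)).trans_le (measure_mono hsub)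
  have hfin := (hull_compact 0 1 Complex.I).measure_lt_top (μ := volume)
  rw [setIntegral_const]
  have : volume.real (convexHull ℝ ({0, 1, Complex.I} : Set ℂ)) ≠ 0 :=
    (ENNReal.toReal_pos hpos.ne' hfin.ne).ne'
  simpa using this

lemma sign_ind (a b c w : ℂ) (h : crs a b c ≠ 0) (h1 : crs w a b ≠ 0) (h2 : crs w b c ≠ 0)
    (h3 : crs w a c ≠ 0) :
    (SignType.sign (crs a b c) : ℝ) *
      (convexHull ℝ ({a, b, c} : Set ℂ)).indicator (fun _ => (1 : ℝ)) w
    = (((SignType.sign (crs w a b) : ℝ)) + (SignType.sign (crs w b c) : ℝ) -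
      (SignType.sign (crs w a c) : ℝ) - (SignType.sign (crs w a b) : ℝ) *
      (SignType.sign (crs w b c) : ℝ) * (SignType.sign (crs w a c) : ℝ)) / 4 := by
  have hD : crs a b c = crs w a b + crs w b c - crs w a c := by unfold crs; ring
  by_cases hw : w ∈ convexHull ℝ ({a, b, c} : Set ℂ)
  · rw [Set.indicator_of_mem hw]
    obtain ⟨x, y, z, hx, hy, hz, hs, rfl⟩ := (mem_hull a b c w).1 hw
    obtain rfl : x = 1 - y - z := by linarith
    generalize hww : ((1 - y - z : ℝ) : ℂ) * a + y * b + z * c = w at *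
    have k1 : crs w a b = z * crs a b c := by rw [← hww]; simp [crs]; ring
    have k2 : crs w b c = (1 - y - z) * crs a b c := by rw [← hww]; simp [crs]; ring
    have k3 : crs w a c = - (y * crs a b c) := by rw [← hww]; simp [crs]; ring
    have hz' : 0 < z := lt_of_le_of_ne hz (by rintro rfl; simp [k1] at h1)
    have hy' : 0 < y := lt_of_le_of_ne hy (by rintro rfl; simp [k3] at h3)
    have hx' : 0 < 1 - y - z := lt_of_le_of_ne hx (by intro h; simp [k2, ← h] at h2)
    rw [k1, k2, k3, Left.sign_neg, sign_mul, sign_mul, sign_mul, sign_pos hz', sign_pos hy',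
      sign_pos hx']
    rcases lt_or_gt_of_ne h with h | h
    · simp [sign_neg h]; norm_num
    · simp [sign_pos h]; norm_num
  · rw [Set.indicator_of_notMem hw]
    have key : ∀ _ : 0 ≤ crs w b c / crs a b c, ∀ _ : 0 ≤ - crs w a c / crs a b c,
        ∀ _ : 0 ≤ crs w a b / crs a b c, False := by
      intro p q r
      apply hw
      rw [mem_hull]
      refine ⟨_, _, _, p, q, r, ?_, ?_⟩
      · field_simp; linarith
      · apply Complex.ext
        · simp [← Complex.ofReal_div, ← Complex.ofReal_neg]; field_simp; unfold crs; ring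
        · simp [← Complex.ofReal_div, ← Complex.ofReal_neg]; field_simp; unfold crs; ring
    rcases lt_or_gt_of_ne h1 with h1 | h1 <;> rcases lt_or_gt_of_ne h2 with h2 | h2 <;>
      rcases lt_or_gt_of_ne h3 with h3 | h3 <;> simp [sign_neg, sign_pos, h1, h2, h3] <;>
      (exfalso
       first
       | exact key (div_nonneg (by linarith) (by linarith)) (div_nonneg (by linarith) (by linarith))
          (div_nonneg (by linarith) (by linarith))
       | exact key (div_nonneg_of_nonpos (by linarith) (by linarith))
          (div_nonneg_of_nonpos (by linarith) (by linarith))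
          (div_nonneg_of_nonpos (by linarith) (by linarith)))

/-- Triple products of the signs cancel, by the Plücker relation. -/
lemma plucker_sign (p q r s t u : ℝ) (hp : p ≠ 0) (hq : q ≠ 0) (hr : r ≠ 0) (hs : s ≠ 0)
    (ht : t ≠ 0) (hu : u ≠ 0) (h : p * u - q * t + r * s = 0) :
    (SignType.sign s : ℝ) * (SignType.sign u : ℝ) * (SignType.sign t : ℝ)
    - (SignType.sign q : ℝ) * (SignType.sign u : ℝ) * (SignType.sign r : ℝ)
    + (SignType.sign p : ℝ) * (SignType.sign t : ℝ) * (SignType.sign r : ℝ)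
    - (SignType.sign p : ℝ) * (SignType.sign s : ℝ) * (SignType.sign q : ℝ) = 0 := by
  have h1 : ¬ (0 < p * u ∧ q * t < 0 ∧ 0 < r * s) := by rintro ⟨a, b, c⟩; linarith
  have h2 : ¬ (p * u < 0 ∧ 0 < q * t ∧ r * s < 0) := by rintro ⟨a, b, c⟩; linarith
  rcases lt_or_gt_of_ne hp with hp | hp <;> rcases lt_or_gt_of_ne hq with hq | hq <;>
  rcases lt_or_gt_of_ne hr with hr | hr <;> rcases lt_or_gt_of_ne hs with hs | hs <;>
  rcases lt_or_gt_of_ne ht with ht | ht <;> rcases lt_or_gt_of_ne hu with hu | hu <;>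
  simp [sign_neg, sign_pos, hp, hq, hr, hs, ht, hu, mul_pos_iff, mul_neg_iff, hp.le.not_gt, hq.le.not_gt, hr.le.not_gt, hs.le.not_gt, ht.le.not_gt, hu.le.not_gt] at h1 h2 ⊢

lemma crs_ne {z : Fin 4 → ℂ} (hz : Nondegenerate z) (i j k : Fin 4) (h1 : i ≠ j) (h2 : i ≠ k)
    (h3 : j ≠ k) : crs (z i) (z j) (z k) ≠ 0 := by
  intro h
  apply hz.2 i j k h1 h2 h3
  have hne : z j - z i ≠ 0 := sub_ne_zero.2 (fun e => h1 (hz.1 e).symm)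
  rw [collinear_iff_of_mem (p₀ := z i) (by simp)]
  refine ⟨z j - z i, ?_⟩
  intro p hp
  simp only [Set.mem_insert_iff, Set.mem_singleton_iff] at hp
  rcases hp with rfl | rfl | rfl
  · exact ⟨0, by simp⟩
  · exact ⟨1, by simp⟩
  · refine ⟨((z k - z i) / (z j - z i)).re, ?_⟩
    have : (z k - z i) / (z j - z i) = (((z k - z i) / (z j - z i)).re : ℂ) := by
      apply Complex.ext
      · simp
      · rw [Complex.div_im]
        simp only [Complex.ofReal_im, Complex.sub_re, Complex.sub_im]
        rw [← sub_div]
        unfold crs at h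
        rw [div_eq_zero_iff]; left; linear_combination h
    simp only [vadd_eq_add, Complex.real_smul]
    rw [← this]
    field_simp
    ring

/-- For a nondegenerate 4-tuple `z_0, …, z_3 ∈ ℂ`, any real polygonal
measure with nodes among the `z_i` whose harmonic moments all vanish is almost everywhere
zero. -/
theorem no_null_measure_four_points
    (z : Fin 4 → ℂ) (hz : Nondegenerate z)
    (c : Fin 4 → Fin 4 → Fin 4 → ℝ)
    (f : ℂ → ℝ)
    (hf : f = fun w =>
      ∑ p ∈ Finset.univ.filter
          (fun p : Fin 4 × Fin 4 × Fin 4 => p.1 < p.2.1 ∧ p.2.1 < p.2.2),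
        c p.1 p.2.1 p.2.2 *
          (convexHull ℝ ({z p.1, z p.2.1, z p.2.2} : Set ℂ)).indicator (fun _ => (1 : ℝ)) w)
    (hmom : ∀ k : ℕ, ∫ w : ℂ, (f w : ℂ) * w ^ k = 0) :
    ∀ᵐ w : ℂ, f w = 0 := by
  have hd0 := crs_ne hz 1 2 3 (by decide) (by decide) (by decide)
  have hd1 := crs_ne hz 0 2 3 (by decide) (by decide) (by decide)
  have hd2 := crs_ne hz 0 1 3 (by decide) (by decide) (by decide)
  have hd3 := crs_ne hz 0 1 2 (by decide) (by decide) (by decide)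
  have hfilt : Finset.univ.filter
      (fun p : Fin 4 × Fin 4 × Fin 4 => p.1 < p.2.1 ∧ p.2.1 < p.2.2) =
      {(1, 2, 3), (0, 2, 3), (0, 1, 3), (0, 1, 2)} := by decide
  rw [hfilt] at hf
  have hf' : ∀ w, f w =
      c 1 2 3 * (convexHull ℝ ({z 1, z 2, z 3} : Set ℂ)).indicator (fun _ => (1 : ℝ)) w
      + c 0 2 3 * (convexHull ℝ ({z 0, z 2, z 3} : Set ℂ)).indicator (fun _ => (1 : ℝ)) w
      + c 0 1 3 * (convexHull ℝ ({z 0, z 1, z 3} : Set ℂ)).indicator (fun _ => (1 : ℝ)) w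
      + c 0 1 2 * (convexHull ℝ ({z 0, z 1, z 2} : Set ℂ)).indicator (fun _ => (1 : ℝ)) w := by
    intro w
    simp only [hf]
    rw [Finset.sum_insert (by decide), Finset.sum_insert (by decide),
      Finset.sum_insert (by decide), Finset.sum_singleton]
    ring
  clear hf
  generalize c 1 2 3 = c0 at *
  generalize c 0 2 3 = c1 at *
  generalize c 0 1 3 = c2 at *
  generalize c 0 1 2 = c3 at *
  have hne : ∀ i j : Fin 4, i ≠ j → z i ≠ z j := fun i j h e => h (hz.1 e)
  have n01 := hne 0 1 (by decide)
  have n02 := hne 0 2 (by decide)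
  have n03 := hne 0 3 (by decide)
  have n12 := hne 1 2 (by decide)
  have n13 := hne 1 3 (by decide)
  have n23 := hne 2 3 (by decide)
  clear hne hz
  generalize z 0 = z0 at *
  generalize z 1 = z1 at *
  generalize z 2 = z2 at *
  generalize z 3 = z3 at *
  have hI : ∀ g : ℂ → ℂ, Continuous g → ∫ w, (f w : ℂ) * g w =
      c0 * (∫ w in convexHull ℝ ({z1, z2, z3} : Set ℂ), g w)
      + c1 * (∫ w in convexHull ℝ ({z0, z2, z3} : Set ℂ), g w)
      + c2 * (∫ w in convexHull ℝ ({z0, z1, z3} : Set ℂ), g w)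
      + c3 * (∫ w in convexHull ℝ ({z0, z1, z2} : Set ℂ), g w) := by
    intro g hg
    have hInteg : ∀ (k : ℝ) (a b d : ℂ), Integrable (fun w => (k : ℂ) * (convexHull ℝ ({a, b, d} : Set ℂ)).indicator g w) := by
      intro k a b d
      apply Integrable.const_mul
      rw [integrable_indicator_iff (hull_compact _ _ _).measurableSet]
      exact hg.continuousOn.integrableOn_compact (hull_compact _ _ _)
    simp only [← integral_indicator (hull_compact _ _ _).measurableSet]
    have a1 := integral_add (hInteg c0 z1 z2 z3) (hInteg c1 z0 z2 z3)
    have a2 := integral_add ((hInteg c0 z1 z2 z3).add (hInteg c1 z0 z2 z3)) (hInteg c2 z0 z1 z3)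
    have a3 := integral_add (((hInteg c0 z1 z2 z3).add (hInteg c1 z0 z2 z3)).add (hInteg c2 z0 z1 z3))
      (hInteg c3 z0 z1 z2)
    simp only [Pi.add_apply] at a1 a2 a3
    rw [a2, a1] at a3
    rw [← integral_const_mul, ← integral_const_mul, ← integral_const_mul, ← integral_const_mul,
      ← a3]
    congr 1
    ext w
    have hi : ∀ s : Set ℂ, s.indicator g w = ((s.indicator (fun _ => (1 : ℝ)) w : ℝ) : ℂ) * g w := by
      intro s
      by_cases h : w ∈ s <;> simp [h]
    simp only [hf', hi]
    push_cast
    ring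
  have m0 := hmom 0
  have m1 := hmom 1
  simp only [pow_zero, pow_one] at m0 m1
  rw [hI _ continuous_const, int_one _ _ _ hd0, int_one _ _ _ hd1, int_one _ _ _ hd2,
    int_one _ _ _ hd3] at m0
  rw [hI (fun w => w) continuous_id, int_id _ _ _ hd0, int_id _ _ _ hd1, int_id _ _ _ hd2,
    int_id _ _ _ hd3] at m1
  have hA := vol_std
  generalize (∫ _w in convexHull ℝ ({0, 1, Complex.I} : Set ℂ), (1 : ℂ)) = A at *
  have s0 : c0 * |crs z1 z2 z3| + c1 * |crs z0 z2 z3| + c2 * |crs z0 z1 z3|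
      + c3 * |crs z0 z1 z2| = 0 := by
    have : ((c0 * |crs z1 z2 z3| + c1 * |crs z0 z2 z3| + c2 * |crs z0 z1 z3|
      + c3 * |crs z0 z1 z2| : ℝ) : ℂ) = 0 := by
      apply mul_left_cancel₀ hA
      push_cast
      linear_combination m0
    exact_mod_cast this
  have s1 : (c0 * |crs z1 z2 z3| : ℝ) * z0 + (c1 * |crs z0 z2 z3| : ℝ) * z1
      + (c2 * |crs z0 z1 z3| : ℝ) * z2 + (c3 * |crs z0 z1 z2| : ℝ) * z3 = 0 := by
    apply mul_left_cancel₀ hA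
    push_cast
    linear_combination (z0 + z1 + z2 + z3) * m0 - 3 * m1
  have s1r := congrArg Complex.re s1
  have s1i := congrArg Complex.im s1
  simp only [Complex.add_re, Complex.add_im, Complex.re_ofReal_mul, Complex.im_ofReal_mul,
    Complex.zero_re, Complex.zero_im] at s1r s1i
  clear m0 m1 hI hmom s1
  have sgnk : ∀ x y p q : ℝ, x ≠ 0 → y ≠ 0 → (p * |x|) * y + (q * |y|) * x = 0 →
      p * (SignType.sign x : ℝ) + q * (SignType.sign y : ℝ) = 0 := by
    intro x y p q hx hy h
    have hx2 : (SignType.sign x : ℝ) * |x| = x := sign_mul_abs x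
    have hy2 : (SignType.sign y : ℝ) * |y| = y := sign_mul_abs y
    have hx3 : (SignType.sign x : ℝ) * SignType.sign x = 1 := by
      rcases lt_or_gt_of_ne hx with h | h <;> simp [sign_neg, sign_pos, h]
    have hy3 : (SignType.sign y : ℝ) * SignType.sign y = 1 := by
      rcases lt_or_gt_of_ne hy with h | h <;> simp [sign_neg, sign_pos, h]
    have hxy : |x| * |y| ≠ 0 := mul_ne_zero (abs_ne_zero.2 hx) (abs_ne_zero.2 hy)
    apply mul_left_cancel₀ hxy
    generalize (SignType.sign x : ℝ) = sx at *
    generalize (SignType.sign y : ℝ) = sy at *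
    have h' : p * |x| * (sy * |y|) + q * |y| * (sx * |x|) = 0 := by rw [hx2, hy2]; exact h
    linear_combination sx * sy * h' - p * |x| * |y| * sx * hy3 - q * |x| * |y| * sy * hx3
  have r12 : c1 * (SignType.sign (crs z0 z2 z3) : ℝ) + c2 * (SignType.sign (crs z0 z1 z3) : ℝ) = 0 := by
    apply sgnk _ _ _ _ hd1 hd2
    generalize c0 * |crs z1 z2 z3| = C0 at *
    generalize c1 * |crs z0 z2 z3| = C1 at *
    generalize c2 * |crs z0 z1 z3| = C2 at *
    generalize c3 * |crs z0 z1 z2| = C3 at *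
    unfold crs
    linear_combination (z3.im - z0.im) * s1r - (z3.re - z0.re) * s1i - ((z3.im - z0.im) * z0.re - (z3.re - z0.re) * z0.im) * s0
  have r23 : c2 * (SignType.sign (crs z0 z1 z3) : ℝ) + c3 * (SignType.sign (crs z0 z1 z2) : ℝ) = 0 := by
    apply sgnk _ _ _ _ hd2 hd3
    generalize c0 * |crs z1 z2 z3| = C0 at *
    generalize c1 * |crs z0 z2 z3| = C1 at *
    generalize c2 * |crs z0 z1 z3| = C2 at *
    generalize c3 * |crs z0 z1 z2| = C3 at *
    unfold crs
    linear_combination -(z1.im - z0.im) * s1r + (z1.re - z0.re) * s1i + ((z1.im - z0.im) * z0.re - (z1.re - z0.re) * z0.im) * s0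
  have r01 : c0 * (SignType.sign (crs z1 z2 z3) : ℝ) + c1 * (SignType.sign (crs z0 z2 z3) : ℝ) = 0 := by
    apply sgnk _ _ _ _ hd0 hd1
    generalize c0 * |crs z1 z2 z3| = C0 at *
    generalize c1 * |crs z0 z2 z3| = C1 at *
    generalize c2 * |crs z0 z1 z3| = C2 at *
    generalize c3 * |crs z0 z1 z2| = C3 at *
    unfold crs
    linear_combination -(z3.im - z2.im) * s1r + (z3.re - z2.re) * s1i + ((z3.im - z2.im) * z2.re - (z3.re - z2.re) * z2.im) * s0
  filter_upwards [line_null z0 z1 n01, line_null z0 z2 n02, line_null z0 z3 n03,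
    line_null z1 z2 n12, line_null z1 z3 n13, line_null z2 z3 n23] with w w01 w02 w03 w12 w13 w23
  have t0 := sign_ind z1 z2 z3 w hd0 w12 w23 w13
  have t1 := sign_ind z0 z2 z3 w hd1 w02 w23 w03
  have t2 := sign_ind z0 z1 z3 w hd2 w01 w13 w03
  have t3 := sign_ind z0 z1 z2 w hd3 w01 w12 w02
  have pl := plucker_sign _ _ _ _ _ _ w01 w02 w03 w12 w13 w23 (by unfold crs; ring)
  rw [hf']
  have sq : ∀ x : ℝ, x ≠ 0 → (SignType.sign x : ℝ) * SignType.sign x = 1 := by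
    intro x hx
    rcases lt_or_gt_of_ne hx with h | h <;> simp [sign_neg, sign_pos, h]
  have q0 := sq _ hd0
  have q1 := sq _ hd1
  have q2 := sq _ hd2
  have q3 := sq _ hd3
  generalize (convexHull ℝ ({z1, z2, z3} : Set ℂ)).indicator (fun _ => (1 : ℝ)) w = x0 at *
  generalize (convexHull ℝ ({z0, z2, z3} : Set ℂ)).indicator (fun _ => (1 : ℝ)) w = x1 at *
  generalize (convexHull ℝ ({z0, z1, z3} : Set ℂ)).indicator (fun _ => (1 : ℝ)) w = x2 at *
  generalize (convexHull ℝ ({z0, z1, z2} : Set ℂ)).indicator (fun _ => (1 : ℝ)) w = x3 at *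
  generalize (SignType.sign (crs z1 z2 z3) : ℝ) = e0 at *
  generalize (SignType.sign (crs z0 z2 z3) : ℝ) = e1 at *
  generalize (SignType.sign (crs z0 z1 z3) : ℝ) = e2 at *
  generalize (SignType.sign (crs z0 z1 z2) : ℝ) = e3 at *
  have tot : e0 * x0 - e1 * x1 + e2 * x2 - e3 * x3 = 0 := by
    rw [t0, t1, t2, t3]
    linear_combination (-1 / 4) * pl
  obtain ⟨l, hl⟩ : ∃ l, l = c0 * e0 := ⟨_, rfl⟩
  have l1 : c1 * e1 = -l := by linarith
  have l2 : c2 * e2 = l := by linarith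
  have l3 : c3 * e3 = -l := by linarith
  linear_combination -c0 * x0 * q0 - c1 * x1 * q1 - c2 * x2 * q2 - c3 * x3 * q3 - e0 * x0 * hl
    + e1 * x1 * l1 + e2 * x2 * l2 + e3 * x3 * l3 + l * tot
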